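/- arXiv:2409.18663 — 12 statements merged into one kernel-verified Lean document; each statement's English description precedes it below -/
import Mathlib

section
/- Fix real constants M̄, Λ, λ. For every r > 0, the function y(r) = 1 − 2M̄/r − (Λ/3)r² − (λ/5)r⁴ is differentiable at r and satisfies y'(r)/r + y(r)/r² = −Λ − λ·r² + 1/r². -/
/-- The Harada vacuum metric function `y(r) = 1 − 2M̄/r − (Λ/3)r² − (λ/5)r⁴`
solves the first-order CKG vacuum equation with `κ₁ = −Λ`, `κ₂ = −λ`. -/
theorem stmt_1 (M Λ lam : ℝ) (r : ℝ) (hr : 0 < r) :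
    DifferentiableAt ℝ
      (fun s : ℝ => 1 - 2 * M / s - Λ / 3 * s ^ 2 - lam / 5 * s ^ 4) r ∧
    deriv (fun s : ℝ => 1 - 2 * M / s - Λ / 3 * s ^ 2 - lam / 5 * s ^ 4) r / r
      + (1 - 2 * M / r - Λ / 3 * r ^ 2 - lam / 5 * r ^ 4) / r ^ 2
      = -Λ - lam * r ^ 2 + 1 / r ^ 2 := by
  have hr0 : r ≠ 0 := hr.ne'
  have h : HasDerivAt
      (fun s : ℝ => 1 - 2 * M / s - Λ / 3 * s ^ 2 - lam / 5 * s ^ 4)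
      (2 * M / r ^ 2 - Λ / 3 * (2 * r) - lam / 5 * (4 * r ^ 3)) r := by
    have h1 : HasDerivAt (fun s : ℝ => 2 * M / s) (-(2 * M / r ^ 2)) r := by
      have := (hasDerivAt_inv hr0).const_mul (2 * M)
      simpa [div_eq_mul_inv] using this
    have h2 : HasDerivAt (fun s : ℝ => Λ / 3 * s ^ 2) (Λ / 3 * (2 * r)) r := by
      simpa using (hasDerivAt_pow 2 r).const_mul (Λ / 3)
    have h3 : HasDerivAt (fun s : ℝ => lam / 5 * s ^ 4) (lam / 5 * (4 * r ^ 3)) r := by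
      simpa using (hasDerivAt_pow 4 r).const_mul (lam / 5)
    have h4 := (((hasDerivAt_const r (1 : ℝ)).sub h1).sub h2).sub h3
    refine h4.congr_deriv ?_
    ring
  refine ⟨h.differentiableAt, ?_⟩
  rw [h.deriv]
  field_simp
  ring
end

section
/- Fix real constants κ₁ > 0, κ₂, κ₃ ≠ 0 and c. For every r > 0, the function y(r) = (κ₁/κ₃)·log(r·√κ₁) + (κ₂/(2κ₃))·r² − 1/(2κ₃·r²) + c is differentiable at r with derivative y'(r) = κ₁/(κ₃·r) + (κ₂/κ₃)·r + 1/(κ₃·r³); equivalently, y satisfies (y'(r)/r)·(κ₃r²) = κ₁ + κ₂·r² + 1/r². -/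
/-- The CKG vacuum solution with `κ₄ = 0`: `y(r) = (κ₁/κ₃)log(r√κ₁)
+ (κ₂/(2κ₃))r² − 1/(2κ₃r²) + c` has derivative `κ₁/(κ₃r) + (κ₂/κ₃)r + 1/(κ₃r³)`,
equivalently it satisfies `(y'/r)(κ₃r²) = κ₁ + κ₂r² + 1/r²`. -/
theorem stmt_2 (κ₁ κ₂ κ₃ c : ℝ) (hκ₁ : 0 < κ₁) (hκ₃ : κ₃ ≠ 0)
    (r : ℝ) (hr : 0 < r) :
    (DifferentiableAt ℝ
      (fun s : ℝ => κ₁ / κ₃ * Real.log (s * Real.sqrt κ₁)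
        + κ₂ / (2 * κ₃) * s ^ 2 - 1 / (2 * κ₃ * s ^ 2) + c) r ∧
     deriv (fun s : ℝ => κ₁ / κ₃ * Real.log (s * Real.sqrt κ₁)
        + κ₂ / (2 * κ₃) * s ^ 2 - 1 / (2 * κ₃ * s ^ 2) + c) r
      = κ₁ / (κ₃ * r) + κ₂ / κ₃ * r + 1 / (κ₃ * r ^ 3)) ∧
    (deriv (fun s : ℝ => κ₁ / κ₃ * Real.log (s * Real.sqrt κ₁)
        + κ₂ / (2 * κ₃) * s ^ 2 - 1 / (2 * κ₃ * s ^ 2) + c) r / r)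
      * (κ₃ * r ^ 2) = κ₁ + κ₂ * r ^ 2 + 1 / r ^ 2 := by
  have hr0 : r ≠ 0 := hr.ne'
  have hs : Real.sqrt κ₁ ≠ 0 := (Real.sqrt_pos.mpr hκ₁).ne'
  have h : HasDerivAt (fun s : ℝ => κ₁ / κ₃ * Real.log (s * Real.sqrt κ₁)
        + κ₂ / (2 * κ₃) * s ^ 2 - 1 / (2 * κ₃ * s ^ 2) + c)
      (κ₁ / (κ₃ * r) + κ₂ / κ₃ * r + 1 / (κ₃ * r ^ 3)) r := by
    have h1 := (((hasDerivAt_id' r).mul_const (Real.sqrt κ₁)).log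
      (mul_ne_zero hr0 hs)).const_mul (κ₁ / κ₃)
    have h2 := (hasDerivAt_pow 2 r).const_mul (κ₂ / (2 * κ₃))
    have h3 := (hasDerivAt_const r (1 : ℝ)).fun_div
      ((hasDerivAt_pow 2 r).const_mul (2 * κ₃))
      (mul_ne_zero (mul_ne_zero two_ne_zero hκ₃) (pow_ne_zero 2 hr0))
    refine (((h1.fun_add h2).fun_sub h3).add_const c).congr_deriv ?_
    push_cast
    field_simp
    ring
  refine ⟨⟨h.differentiableAt, h.deriv⟩, ?_⟩
  rw [h.deriv]
  field_simp
end

section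
/- Fix real constants C, κ₁, κ₂ and κ₃ > 0, κ₄ > 0. For every r > 0, the function y(r) = C·√(κ₃r² + κ₄)/r + 1/κ₄ + (κ₂/(2κ₃))·r² + (κ₁/κ₃ − (3/2)·κ₂κ₄/κ₃²)·( (√(κ₃r² + κ₄)/(r·√κ₃))·arsinh(r·√(κ₃/κ₄)) − 1 ) is differentiable at r and satisfies (y'(r)/r)·(κ₃r² + κ₄) + κ₄·y(r)/r² = κ₁ + κ₂·r² + 1/r², where arsinh denotes the inverse hyperbolic sine. -/
/-- The general CKG vacuum solution for `κ₃ > 0`, `κ₄ > 0` (ArcSinh case)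
solves `(y'/r)(κ₃r² + κ₄) + κ₄ y/r² = κ₁ + κ₂r² + 1/r²`. -/
theorem stmt_4 (C κ₁ κ₂ κ₃ κ₄ : ℝ) (hκ₃ : 0 < κ₃) (hκ₄ : 0 < κ₄)
    (r : ℝ) (hr : 0 < r) :
    DifferentiableAt ℝ
      (fun s : ℝ => C * Real.sqrt (κ₃ * s ^ 2 + κ₄) / s + 1 / κ₄
        + κ₂ / (2 * κ₃) * s ^ 2
        + (κ₁ / κ₃ - 3 / 2 * (κ₂ * κ₄ / κ₃ ^ 2))
          * (Real.sqrt (κ₃ * s ^ 2 + κ₄) / (s * Real.sqrt κ₃)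
              * Real.arsinh (s * Real.sqrt (κ₃ / κ₄)) - 1)) r ∧
    (deriv (fun s : ℝ => C * Real.sqrt (κ₃ * s ^ 2 + κ₄) / s + 1 / κ₄
        + κ₂ / (2 * κ₃) * s ^ 2
        + (κ₁ / κ₃ - 3 / 2 * (κ₂ * κ₄ / κ₃ ^ 2))
          * (Real.sqrt (κ₃ * s ^ 2 + κ₄) / (s * Real.sqrt κ₃)
              * Real.arsinh (s * Real.sqrt (κ₃ / κ₄)) - 1)) r / r)
        * (κ₃ * r ^ 2 + κ₄)
      + κ₄ * (C * Real.sqrt (κ₃ * r ^ 2 + κ₄) / r + 1 / κ₄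
        + κ₂ / (2 * κ₃) * r ^ 2
        + (κ₁ / κ₃ - 3 / 2 * (κ₂ * κ₄ / κ₃ ^ 2))
          * (Real.sqrt (κ₃ * r ^ 2 + κ₄) / (r * Real.sqrt κ₃)
              * Real.arsinh (r * Real.sqrt (κ₃ / κ₄)) - 1)) / r ^ 2
      = κ₁ + κ₂ * r ^ 2 + 1 / r ^ 2 := by
  have hP : 0 < κ₃ * r ^ 2 + κ₄ := by positivity
  obtain ⟨S, hS⟩ : ∃ S, S = Real.sqrt (κ₃ * r ^ 2 + κ₄) := ⟨_, rfl⟩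
  obtain ⟨a, ha⟩ : ∃ a, a = Real.sqrt κ₃ := ⟨_, rfl⟩
  have hSpos : 0 < S := hS ▸ Real.sqrt_pos.mpr hP
  have hapos : 0 < a := ha ▸ Real.sqrt_pos.mpr hκ₃
  have hS2 : S ^ 2 = κ₃ * r ^ 2 + κ₄ := by rw [hS]; exact Real.sq_sqrt hP.le
  have ha2 : a ^ 2 = κ₃ := by rw [ha]; exact Real.sq_sqrt hκ₃.le
  have hid : HasDerivAt (fun s : ℝ => s) 1 r := hasDerivAt_id r
  have hsq : HasDerivAt (fun s : ℝ => s ^ 2) (2 * r) r := by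
    simpa using hasDerivAt_pow 2 r
  have h1 : HasDerivAt (fun s : ℝ => Real.sqrt (κ₃ * s ^ 2 + κ₄)) (κ₃ * r / S) r := by
    have := ((hsq.const_mul κ₃).add_const κ₄).sqrt hP.ne'
    rw [← hS] at this
    refine this.congr_deriv ?_
    field_simp
  have h2 : HasDerivAt (fun s : ℝ => Real.arsinh (s * Real.sqrt (κ₃ / κ₄))) (a / S) r := by
    have := (hid.mul_const (Real.sqrt (κ₃ / κ₄))).arsinh
    refine this.congr_deriv ?_
    have e : 1 + (r * Real.sqrt (κ₃ / κ₄)) ^ 2 = (κ₃ * r ^ 2 + κ₄) / κ₄ := by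
      rw [mul_pow, Real.sq_sqrt (by positivity)]; field_simp; ring
    rw [e, Real.sqrt_div hP.le, Real.sqrt_div hκ₃.le, ← hS, ← ha, smul_eq_mul]
    have : 0 < Real.sqrt κ₄ := Real.sqrt_pos.mpr hκ₄
    field_simp
  have h3 : HasDerivAt (fun s : ℝ => C * Real.sqrt (κ₃ * s ^ 2 + κ₄) / s)
      (-(C * κ₄ / (S * r ^ 2))) r := by
    refine ((h1.const_mul C).div hid hr.ne').congr_deriv ?_
    rw [← hS]
    field_simp
    rw [hS2]; ring
  have h4 : HasDerivAt (fun s : ℝ => Real.sqrt (κ₃ * s ^ 2 + κ₄) / (s * Real.sqrt κ₃))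
      (-(κ₄ / (S * r ^ 2 * a))) r := by
    rw [← ha]
    refine (h1.div (hid.mul_const a) (by positivity)).congr_deriv ?_
    rw [← hS]
    field_simp
    rw [hS2]; ring
  have h := ((h3.add_const (1 / κ₄)).add (hsq.const_mul (κ₂ / (2 * κ₃)))).add
    (((h4.mul h2).sub_const 1).const_mul (κ₁ / κ₃ - 3 / 2 * (κ₂ * κ₄ / κ₃ ^ 2)))
  refine ⟨h.differentiableAt, ?_⟩
  have hd := h.deriv
  refine (congrArg (fun d => d / r * (κ₃ * r ^ 2 + κ₄) + _) hd).trans ?_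
  rw [← hS, ← ha]
  generalize Real.arsinh (r * Real.sqrt (κ₃ / κ₄)) = A
  have hκ₄' : κ₄ = S ^ 2 - κ₃ * r ^ 2 := by linarith
  rw [← hS2]
  have e1 : κ₄ * (1 / κ₄) = 1 := by field_simp
  have e2 : ∀ x y z : ℝ, κ₄ * (x + 1 / κ₄ + y + z) = κ₄ * x + 1 + κ₄ * y + κ₄ * z := by
    intro x y z; linear_combination e1
  rw [e2]
  clear e1 e2 hd h h1 h2 h3 h4 hS ha
  subst hκ₄'
  subst ha2
  field_simp
  ring
end

section
/- Fix real constants C, κ₁, κ₂ and κ₃ > 0, κ₄ < 0. For every r > √(−κ₄/κ₃), the function y(r) = C·√(κ₃r² + κ₄)/r + 1/κ₄ + (κ₂/(2κ₃))·r² + (κ₁/κ₃ − (3/2)·κ₂κ₄/κ₃²)·( (√(κ₃r² + κ₄)/(r·√κ₃))·log( r·√(κ₃/(−κ₄)) + √(κ₃r²/(−κ₄) − 1) ) − 1 ) is differentiable at r and satisfies (y'(r)/r)·(κ₃r² + κ₄) + κ₄·y(r)/r² = κ₁ + κ₂·r² + 1/r². (Here log(x + √(x² − 1)) is the inverse hyperbolic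 cosine arcosh x.) -/
/-- The general CKG vacuum solution for `κ₃ > 0`, `κ₄ < 0` (ArcCosh case)
solves `(y'/r)(κ₃r² + κ₄) + κ₄ y/r² = κ₁ + κ₂r² + 1/r²` for
`r > √(−κ₄/κ₃)`. -/
theorem stmt_5 (C κ₁ κ₂ κ₃ κ₄ : ℝ) (hκ₃ : 0 < κ₃) (hκ₄ : κ₄ < 0)
    (r : ℝ) (hr : Real.sqrt (-κ₄ / κ₃) < r) :
    DifferentiableAt ℝ
      (fun s : ℝ => C * Real.sqrt (κ₃ * s ^ 2 + κ₄) / s + 1 / κ₄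
        + κ₂ / (2 * κ₃) * s ^ 2
        + (κ₁ / κ₃ - 3 / 2 * (κ₂ * κ₄ / κ₃ ^ 2))
          * (Real.sqrt (κ₃ * s ^ 2 + κ₄) / (s * Real.sqrt κ₃)
              * Real.log (s * Real.sqrt (κ₃ / (-κ₄))
                  + Real.sqrt (κ₃ * s ^ 2 / (-κ₄) - 1)) - 1)) r ∧
    (deriv (fun s : ℝ => C * Real.sqrt (κ₃ * s ^ 2 + κ₄) / s + 1 / κ₄
        + κ₂ / (2 * κ₃) * s ^ 2
        + (κ₁ / κ₃ - 3 / 2 * (κ₂ * κ₄ / κ₃ ^ 2))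
          * (Real.sqrt (κ₃ * s ^ 2 + κ₄) / (s * Real.sqrt κ₃)
              * Real.log (s * Real.sqrt (κ₃ / (-κ₄))
                  + Real.sqrt (κ₃ * s ^ 2 / (-κ₄) - 1)) - 1)) r / r)
        * (κ₃ * r ^ 2 + κ₄)
      + κ₄ * (C * Real.sqrt (κ₃ * r ^ 2 + κ₄) / r + 1 / κ₄
        + κ₂ / (2 * κ₃) * r ^ 2
        + (κ₁ / κ₃ - 3 / 2 * (κ₂ * κ₄ / κ₃ ^ 2))
          * (Real.sqrt (κ₃ * r ^ 2 + κ₄) / (r * Real.sqrt κ₃)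
              * Real.log (r * Real.sqrt (κ₃ / (-κ₄))
                  + Real.sqrt (κ₃ * r ^ 2 / (-κ₄) - 1)) - 1)) / r ^ 2
      = κ₁ + κ₂ * r ^ 2 + 1 / r ^ 2 := by
  have hr0 : 0 < r := lt_of_le_of_lt (Real.sqrt_nonneg _) hr
  have hq : -κ₄ / κ₃ < r ^ 2 := (Real.sqrt_lt' hr0).1 hr
  have hn : 0 < -κ₄ := by linarith
  have hS2 : 0 < κ₃ * r ^ 2 + κ₄ := by
    rw [div_lt_iff₀ hκ₃] at hq
    linarith
  have hTS : κ₃ * r ^ 2 / (-κ₄) - 1 = (κ₃ * r ^ 2 + κ₄) / (-κ₄) := by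
    rw [div_sub_one hn.ne']
    ring
  have hT2 : 0 < κ₃ * r ^ 2 / (-κ₄) - 1 := by
    rw [hTS]
    positivity
  have hS := Real.sqrt_pos.2 hS2
  have hT := Real.sqrt_pos.2 hT2
  have hg : 0 < Real.sqrt κ₃ := Real.sqrt_pos.2 hκ₃
  have hb : 0 < Real.sqrt (-κ₄) := Real.sqrt_pos.2 hn
  have ha : 0 < Real.sqrt (κ₃ / (-κ₄)) := Real.sqrt_pos.2 (by positivity)
  have hSsq := Real.sq_sqrt hS2.le
  have hgsq := Real.sq_sqrt hκ₃.le
  have hbsq := Real.sq_sqrt hn.le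
  have haeq : Real.sqrt (κ₃ / (-κ₄)) = Real.sqrt κ₃ / Real.sqrt (-κ₄) := Real.sqrt_div hκ₃.le _
  have hTeq : Real.sqrt (κ₃ * r ^ 2 / (-κ₄) - 1)
      = Real.sqrt (κ₃ * r ^ 2 + κ₄) / Real.sqrt (-κ₄) := by
    rw [hTS]
    exact Real.sqrt_div hS2.le _
  have hsq : HasDerivAt (fun s : ℝ => s ^ 2) (2 * r) r := by
    simpa using hasDerivAt_pow 2 r
  have dS : HasDerivAt (fun s : ℝ => Real.sqrt (κ₃ * s ^ 2 + κ₄))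
      (κ₃ * r / Real.sqrt (κ₃ * r ^ 2 + κ₄)) r := by
    convert ((hsq.const_mul κ₃).add_const κ₄).sqrt hS2.ne' using 1
    field_simp
  have dT : HasDerivAt (fun s : ℝ => Real.sqrt (κ₃ * s ^ 2 / (-κ₄) - 1))
      (κ₃ * (2 * r) / (-κ₄) / (2 * Real.sqrt (κ₃ * r ^ 2 / (-κ₄) - 1))) r :=
    (((hsq.const_mul κ₃).div_const (-κ₄)).sub_const 1).sqrt hT2.ne'
  have dL : HasDerivAt (fun s : ℝ => Real.log (s * Real.sqrt (κ₃ / (-κ₄))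
                  + Real.sqrt (κ₃ * s ^ 2 / (-κ₄) - 1)))
      (Real.sqrt κ₃ / Real.sqrt (κ₃ * r ^ 2 + κ₄)) r := by
    have hpos : 0 < r * Real.sqrt (κ₃ / (-κ₄)) + Real.sqrt (κ₃ * r ^ 2 / (-κ₄) - 1) := by
      positivity
    convert (((hasDerivAt_id r).mul_const (Real.sqrt (κ₃ / (-κ₄)))).add dT).log hpos.ne' using 1
    · rfl
    change _ = _ / (r * Real.sqrt (κ₃ / (-κ₄)) + Real.sqrt (κ₃ * r ^ 2 / (-κ₄) - 1))
    rw [eq_div_iff hpos.ne', haeq, hTeq]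
    generalize Real.sqrt (κ₃ * r ^ 2 + κ₄) = S at *
    generalize Real.sqrt (-κ₄) = b at *
    rw [← hbsq]
    field_simp
    linear_combination r * hgsq
  have dY := ((((dS.const_mul C).div (hasDerivAt_id r) hr0.ne').add_const (1 / κ₄)).add
    (hsq.const_mul (κ₂ / (2 * κ₃)))).add
    ((((dS.div ((hasDerivAt_id r).mul_const (Real.sqrt κ₃))
      (mul_pos hr0 hg).ne').mul dL).sub_const 1).const_mul
      (κ₁ / κ₃ - 3 / 2 * (κ₂ * κ₄ / κ₃ ^ 2)))
  refine ⟨dY.differentiableAt, ?_⟩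
  have hd := dY.deriv
  simp only [id, Pi.add_apply, Pi.div_apply, Pi.mul_apply] at hd
  refine (congrArg (fun d => d / r * (κ₃ * r ^ 2 + κ₄) + _) hd).trans ?_
  generalize Real.log _ = L
  have hk4 : κ₄ = Real.sqrt (κ₃ * r ^ 2 + κ₄) ^ 2 - κ₃ * r ^ 2 := by linarith
  have hne := hκ₄.ne
  clear hd dY dL dT dS
  generalize Real.sqrt (κ₃ * r ^ 2 + κ₄) = S at *
  generalize Real.sqrt κ₃ = g at *
  rw [← hSsq]
  subst hgsq
  field_simp
  rw [hk4]
  ring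
end

section
/- Fix real constants C, κ₁, κ₂ and κ₃ < 0, κ₄ > 0. For every r with 0 < r < √(κ₄/(−κ₃)), the function y(r) = C·√(κ₃r² + κ₄)/r + 1/κ₄ + (κ₂/(2κ₃))·r² + (κ₁/κ₃ − (3/2)·κ₂κ₄/κ₃²)·( (√(κ₃r² + κ₄)/(r·√(−κ₃)))·arcsin(r·√(−κ₃/κ₄)) − 1 ) is differentiable at r and satisfies (y'(r)/r)·(κ₃r² + κ₄) + κ₄·y(r)/r² = κ₁ + κ₂·r² + 1/r². -/
/-- The general CKG vacuum solution for `κ₃ < 0`, `κ₄ > 0` (ArcSin case)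
solves `(y'/r)(κ₃r² + κ₄) + κ₄ y/r² = κ₁ + κ₂r² + 1/r²` for
`0 < r < √(κ₄/(−κ₃))`. -/
theorem stmt_6 (C κ₁ κ₂ κ₃ κ₄ : ℝ) (hκ₃ : κ₃ < 0) (hκ₄ : 0 < κ₄)
    (r : ℝ) (hr0 : 0 < r) (hr : r < Real.sqrt (κ₄ / (-κ₃))) :
    DifferentiableAt ℝ
      (fun s : ℝ => C * Real.sqrt (κ₃ * s ^ 2 + κ₄) / s + 1 / κ₄
        + κ₂ / (2 * κ₃) * s ^ 2
        + (κ₁ / κ₃ - 3 / 2 * (κ₂ * κ₄ / κ₃ ^ 2))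
          * (Real.sqrt (κ₃ * s ^ 2 + κ₄) / (s * Real.sqrt (-κ₃))
              * Real.arcsin (s * Real.sqrt (-κ₃ / κ₄)) - 1)) r ∧
    (deriv (fun s : ℝ => C * Real.sqrt (κ₃ * s ^ 2 + κ₄) / s + 1 / κ₄
        + κ₂ / (2 * κ₃) * s ^ 2
        + (κ₁ / κ₃ - 3 / 2 * (κ₂ * κ₄ / κ₃ ^ 2))
          * (Real.sqrt (κ₃ * s ^ 2 + κ₄) / (s * Real.sqrt (-κ₃))
              * Real.arcsin (s * Real.sqrt (-κ₃ / κ₄)) - 1)) r / r)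
        * (κ₃ * r ^ 2 + κ₄)
      + κ₄ * (C * Real.sqrt (κ₃ * r ^ 2 + κ₄) / r + 1 / κ₄
        + κ₂ / (2 * κ₃) * r ^ 2
        + (κ₁ / κ₃ - 3 / 2 * (κ₂ * κ₄ / κ₃ ^ 2))
          * (Real.sqrt (κ₃ * r ^ 2 + κ₄) / (r * Real.sqrt (-κ₃))
              * Real.arcsin (r * Real.sqrt (-κ₃ / κ₄)) - 1)) / r ^ 2
      = κ₁ + κ₂ * r ^ 2 + 1 / r ^ 2 := by
  have hn : 0 < -κ₃ := by linarith
  have hP : 0 < κ₃ * r ^ 2 + κ₄ := by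
    have h := (Real.lt_sqrt hr0.le).1 hr
    rw [lt_div_iff₀ hn] at h
    nlinarith
  have hu : 0 < Real.sqrt (κ₃ * r ^ 2 + κ₄) := Real.sqrt_pos.2 hP
  have hw : 0 < Real.sqrt (-κ₃) := Real.sqrt_pos.2 hn
  have hu2 : Real.sqrt (κ₃ * r ^ 2 + κ₄) ^ 2 = κ₃ * r ^ 2 + κ₄ := Real.sq_sqrt hP.le
  have hw2 : Real.sqrt (-κ₃) ^ 2 = -κ₃ := Real.sq_sqrt hn.le
  have hk : 0 < Real.sqrt κ₄ := Real.sqrt_pos.2 hκ₄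
  have hq2 : Real.sqrt (-κ₃ / κ₄) ^ 2 = -κ₃ / κ₄ := Real.sq_sqrt (div_pos hn hκ₄).le
  have hq0 : 0 < Real.sqrt (-κ₃ / κ₄) := Real.sqrt_pos.2 (div_pos hn hκ₄)
  have h1 : 1 - (r * Real.sqrt (-κ₃ / κ₄)) ^ 2 = (κ₃ * r ^ 2 + κ₄) / κ₄ := by
    rw [mul_pow, hq2]; field_simp; ring
  have h1p : 0 < 1 - (r * Real.sqrt (-κ₃ / κ₄)) ^ 2 := by rw [h1]; positivity
  have hsin : HasDerivAt (fun s : ℝ => Real.arcsin (s * Real.sqrt (-κ₃ / κ₄)))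
      (Real.sqrt (-κ₃) / Real.sqrt (κ₃ * r ^ 2 + κ₄)) r := by
    have ha := Real.hasDerivAt_arcsin (x := r * Real.sqrt (-κ₃ / κ₄))
      (by nlinarith [mul_pos hr0 hq0]) (by nlinarith [mul_pos hr0 hq0])
    have hb : HasDerivAt (fun s : ℝ => s * Real.sqrt (-κ₃ / κ₄)) (1 * Real.sqrt (-κ₃ / κ₄)) r :=
      (hasDerivAt_id r).mul_const _
    have hc := HasDerivAt.comp r ha hb
    refine hc.congr_deriv ?_
    rw [h1, Real.sqrt_div hP.le, Real.sqrt_div hn.le]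
    field_simp
  have hsq : HasDerivAt (fun s : ℝ => Real.sqrt (κ₃ * s ^ 2 + κ₄))
      (κ₃ * r / Real.sqrt (κ₃ * r ^ 2 + κ₄)) r := by
    have h := ((((hasDerivAt_id r).pow 2).const_mul κ₃).add_const κ₄).sqrt (by simpa using hP.ne')
    refine h.congr_deriv ?_
    simp
    field_simp
  have hy := ((((hsq.const_mul C).div (hasDerivAt_id r) hr0.ne').add_const (1 / κ₄)).add
    (((hasDerivAt_id r).pow 2).const_mul (κ₂ / (2 * κ₃)))).add
    ((((hsq.div ((hasDerivAt_id r).mul_const (Real.sqrt (-κ₃)))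
      (mul_pos hr0 hw).ne').mul hsin).sub_const 1).const_mul
        (κ₁ / κ₃ - 3 / 2 * (κ₂ * κ₄ / κ₃ ^ 2)))
  refine ⟨hy.differentiableAt, ?_⟩
  erw [hy.deriv]
  simp only [id]
  generalize Real.arcsin (r * Real.sqrt (-κ₃ / κ₄)) = a
  clear hy hsq hsin h1p h1 hq0 hq2 hk
  generalize Real.sqrt (κ₃ * r ^ 2 + κ₄) = u at *
  generalize Real.sqrt (-κ₃) = w at *
  obtain rfl : κ₄ = u ^ 2 - κ₃ * r ^ 2 := by linarith
  obtain rfl : κ₃ = -w ^ 2 := by linarith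
  have := hκ₄.ne'
  simp [Real.sqrt_sq hu.le]
  field_simp
  ring
end

section
/- Fix real constants κ₁, κ₂, κ₃, κ₄. Let I ⊆ (0, ∞) be an open interval on which κ₃·r² + κ₄ ≠ 0, and let y : I → ℝ be differentiable with (y'(r)/r)·(κ₃r² + κ₄) + κ₄·y(r)/r² = κ₁ + κ₂·r² + 1/r² for all r ∈ I. Then y is twice differentiable on I, and for all r ∈ I both y''(r)·(κ₃r² + κ₄) + y'(r)·κ₃·r − 2κ₄·y(r)/r² = 2κ₂·r² − 2/r² and y''(r)·(κ₃r² + κ₄) + (y'(r)/r)·(3κ₃r² + 2κ₄) = 4κ₂·r² + 2κ₁ hold. -/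
/-- If `y` solves the first-order CKG vacuum equation on an open interval
`I ⊆ (0,∞)` where `κ₃r² + κ₄ ≠ 0`, then `y` is twice differentiable on `I`
and satisfies both second-order CKG vacuum equations there. -/
theorem stmt_7 (κ₁ κ₂ κ₃ κ₄ : ℝ) (a b : ℝ) (I : Set ℝ) (hI : I = Set.Ioo a b)
    (hIpos : I ⊆ Set.Ioi 0) (hne : ∀ r ∈ I, κ₃ * r ^ 2 + κ₄ ≠ 0)
    (y : ℝ → ℝ) (hdiff : ∀ r ∈ I, DifferentiableAt ℝ y r)
    (hode : ∀ r ∈ I,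
      (deriv y r / r) * (κ₃ * r ^ 2 + κ₄) + κ₄ * y r / r ^ 2
        = κ₁ + κ₂ * r ^ 2 + 1 / r ^ 2) :
    ∀ r ∈ I, DifferentiableAt ℝ (deriv y) r ∧
      (deriv (deriv y) r * (κ₃ * r ^ 2 + κ₄) + deriv y r * κ₃ * r
          - 2 * κ₄ * y r / r ^ 2 = 2 * κ₂ * r ^ 2 - 2 / r ^ 2) ∧
      (deriv (deriv y) r * (κ₃ * r ^ 2 + κ₄)
          + (deriv y r / r) * (3 * κ₃ * r ^ 2 + 2 * κ₄)
          = 4 * κ₂ * r ^ 2 + 2 * κ₁) := by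
  intro r hr
  have hopen : IsOpen I := hI ▸ isOpen_Ioo
  have hnhds : I ∈ nhds r := hopen.mem_nhds hr
  have hpoly : ∀ x ∈ I, deriv y x * (κ₃ * x ^ 3 + κ₄ * x) + κ₄ * y x
      = κ₁ * x ^ 2 + κ₂ * x ^ 4 + 1 := by
    intro x hx
    have hx0 : x ≠ 0 := ne_of_gt (hIpos hx)
    have h := hode x hx
    field_simp at h
    linarith
  have hr0 : r ≠ 0 := ne_of_gt (hIpos hr)
  have hW : ∀ x ∈ I, κ₃ * x ^ 3 + κ₄ * x ≠ 0 := by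
    intro x hx
    have hx0 : x ≠ 0 := ne_of_gt (hIpos hx)
    have h := mul_ne_zero (hne x hx) hx0
    intro h0
    exact h (by linarith)
  have heq : deriv y =ᶠ[nhds r] fun x =>
      (κ₁ * x ^ 2 + κ₂ * x ^ 4 + 1 - κ₄ * y x) / (κ₃ * x ^ 3 + κ₄ * x) := by
    filter_upwards [hnhds] with x hx
    rw [eq_div_iff (hW x hx)]
    linarith [hpoly x hx]
  have hy := hdiff r hr
  have hd : DifferentiableAt ℝ (deriv y) r := by
    refine DifferentiableAt.congr_of_eventuallyEq ?_ heq
    exact DifferentiableAt.div (by fun_prop) (by fun_prop) (hW r hr)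
  have h1 := (hd.hasDerivAt.mul ((((hasDerivAt_id r).pow 3).const_mul κ₃).add
    ((hasDerivAt_id r).const_mul κ₄))).add (hy.hasDerivAt.const_mul κ₄)
  have h2 := ((((hasDerivAt_id r).pow 2).const_mul κ₁).add
    (((hasDerivAt_id r).pow 4).const_mul κ₂)).add_const 1
  have h3 := h1.unique (h2.congr_of_eventuallyEq (by
    filter_upwards [hnhds] with x hx
    simpa using hpoly x hx))
  simp at h3
  have hsecond : deriv (deriv y) r * (κ₃ * r ^ 2 + κ₄)
          + (deriv y r / r) * (3 * κ₃ * r ^ 2 + 2 * κ₄)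
          = 4 * κ₂ * r ^ 2 + 2 * κ₁ := by
    field_simp
    linarith
  refine ⟨hd, ?_, hsecond⟩
  have h4 := hode r hr
  have e1 : deriv y r / r * r ^ 2 = deriv y r * r := by field_simp
  linear_combination hsecond - 2 * h4 - κ₃ * e1
end

section
/- Fix r > 0 and real constants C, κ₁, κ₂. Then the limit as κ₃ → 0 through positive values of C·√(κ₃r² + 1)/r + 1 + (κ₂/(2κ₃))·r² + (κ₁/κ₃ − (3/2)·κ₂/κ₃²)·( (√(κ₃r² + 1)/(r·√κ₃))·arsinh(r·√κ₃) − 1 ) exists and equals C/r + 1 + (κ₁/3)·r² + (κ₂/5)·r⁴, where arsinh denotes the inverse hyperbolic sine. -/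
open Filter Topology

lemma aux_deriv (x : ℝ) :
    HasDerivAt (fun x : ℝ => Real.arsinh x - (x + x ^ 3 / 3) / Real.sqrt (1 + x ^ 2))
      (-(2 / 3) * x ^ 4 / Real.sqrt (1 + x ^ 2) ^ 3) x := by
  have hp : (0 : ℝ) < 1 + x ^ 2 := by positivity
  have hs : 0 < Real.sqrt (1 + x ^ 2) := Real.sqrt_pos.2 hp
  have hsq : Real.sqrt (1 + x ^ 2) ^ 2 = 1 + x ^ 2 := Real.sq_sqrt hp.le
  have h1 : HasDerivAt (fun x : ℝ => 1 + x ^ 2) (2 * x) x := by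
    simpa using (hasDerivAt_pow 2 x).const_add 1
  have h2 := h1.sqrt hp.ne'
  have h3 : HasDerivAt (fun x : ℝ => x + x ^ 3 / 3) (1 + x ^ 2) x := by
    have := (hasDerivAt_id x).add ((hasDerivAt_pow 3 x).div_const 3)
    exact this.congr_deriv (by ring)
  have h4 := (Real.hasDerivAt_arsinh x).sub (h3.div h2 hs.ne')
  refine h4.congr_deriv ?_
  generalize Real.sqrt (1 + x ^ 2) = s at *
  field_simp
  have h4 : s ^ 4 = (1 + x ^ 2) ^ 2 := by rw [← hsq]; ring
  rw [hsq]
  ring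

lemma aux_lim :
    Tendsto (fun x : ℝ => (Real.arsinh x - (x + x ^ 3 / 3) / Real.sqrt (1 + x ^ 2)) / x ^ 5)
      (𝓝[>] 0) (𝓝 (-(2 / 15))) := by
  have hc : Continuous (fun x : ℝ => Real.arsinh x - (x + x ^ 3 / 3) / Real.sqrt (1 + x ^ 2)) :=
    continuous_iff_continuousAt.2 fun x => (aux_deriv x).continuousAt
  refine HasDerivAt.lhopital_zero_nhdsGT
    (f' := fun x => -(2 / 3) * x ^ 4 / Real.sqrt (1 + x ^ 2) ^ 3)
    (g' := fun x => 5 * x ^ 4)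
    (Eventually.of_forall aux_deriv)
    (Eventually.of_forall fun x => by simpa using hasDerivAt_pow 5 x) ?_ ?_ ?_ ?_
  · filter_upwards [self_mem_nhdsWithin] with x hx
    have : (0 : ℝ) < x := hx
    positivity
  · have := hc.tendsto 0
    simp at this
    exact this.mono_left nhdsWithin_le_nhds
  · have := (continuous_pow (M := ℝ) 5).tendsto 0
    simp at this
    exact this.mono_left nhdsWithin_le_nhds
  · have h : ContinuousAt (fun x : ℝ => -(2 / 15) / Real.sqrt (1 + x ^ 2) ^ 3) 0 := by
      refine ContinuousAt.div (by fun_prop) (by fun_prop) (by simp)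
    have h' := h.tendsto.mono_left (nhdsWithin_le_nhds (s := Set.Ioi 0))
    simp only [ne_eq, OfNat.ofNat_ne_zero, not_false_eq_true, zero_pow, add_zero, Real.sqrt_one,
      one_pow, div_one] at h'
    refine h'.congr' ?_
    filter_upwards [self_mem_nhdsWithin] with x hx
    have : (0 : ℝ) < x := hx
    have hs : 0 < Real.sqrt (1 + x ^ 2) := Real.sqrt_pos.2 (by positivity)
    field_simp
    norm_num

/-- In the limit `κ₃ → 0⁺` the general CKG vacuum solution with `κ₄ = 1`
reduces to the Harada vacuum form `C/r + 1 + (κ₁/3)r² + (κ₂/5)r⁴`. -/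
theorem stmt_8 (r : ℝ) (hr : 0 < r) (C κ₁ κ₂ : ℝ) :
    Tendsto
      (fun κ₃ : ℝ => C * Real.sqrt (κ₃ * r ^ 2 + 1) / r + 1
        + κ₂ / (2 * κ₃) * r ^ 2
        + (κ₁ / κ₃ - 3 / 2 * (κ₂ / κ₃ ^ 2))
          * (Real.sqrt (κ₃ * r ^ 2 + 1) / (r * Real.sqrt κ₃)
              * Real.arsinh (r * Real.sqrt κ₃) - 1))
      (𝓝[>] 0)
      (𝓝 (C / r + 1 + κ₁ / 3 * r ^ 2 + κ₂ / 5 * r ^ 4)) := by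
  have hx : Tendsto (fun k : ℝ => r * Real.sqrt k) (𝓝[>] 0) (𝓝[>] 0) := by
    refine tendsto_nhdsWithin_iff.2 ⟨?_, ?_⟩
    · have h : Continuous (fun k : ℝ => r * Real.sqrt k) := by fun_prop
      have := h.tendsto 0
      simp only [Real.sqrt_zero, mul_zero] at this
      exact this.mono_left nhdsWithin_le_nhds
    · filter_upwards [self_mem_nhdsWithin] with k hk
      exact mul_pos hr (Real.sqrt_pos.2 hk)
  have hB := aux_lim.comp hx
  have hs : Tendsto (fun k : ℝ => Real.sqrt (k * r ^ 2 + 1)) (𝓝[>] 0) (𝓝 1) := by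
    have h : Continuous (fun k : ℝ => Real.sqrt (k * r ^ 2 + 1)) := by fun_prop
    have := h.tendsto 0
    simp only [zero_mul, zero_add, Real.sqrt_one] at this
    exact this.mono_left nhdsWithin_le_nhds
  have hk : Tendsto (fun k : ℝ => k) (𝓝[>] 0) (𝓝 0) := tendsto_id.mono_left nhdsWithin_le_nhds
  have key := (((hs.const_mul C).div_const r).add_const (1 + κ₁ / 3 * r ^ 2)).add
    ((((hk.const_mul κ₁).sub_const (3 / 2 * κ₂)).mul_const (r ^ 4)).mul (hs.mul hB))
  have e : C * 1 / r + (1 + κ₁ / 3 * r ^ 2) + (κ₁ * 0 - 3 / 2 * κ₂) * r ^ 4 * (1 * -(2 / 15))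
      = C / r + 1 + κ₁ / 3 * r ^ 2 + κ₂ / 5 * r ^ 4 := by ring
  rw [e] at key
  refine key.congr' ?_
  filter_upwards [self_mem_nhdsWithin] with k hk0
  have hk0 : (0 : ℝ) < k := hk0
  have e1 : 1 + (r * Real.sqrt k) ^ 2 = k * r ^ 2 + 1 := by
    rw [mul_pow, Real.sq_sqrt hk0.le]; ring
  have hS : 0 < Real.sqrt (k * r ^ 2 + 1) := Real.sqrt_pos.2 (by positivity)
  have hq : 0 < Real.sqrt k := Real.sqrt_pos.2 hk0
  simp only [Function.comp, e1]
  generalize Real.sqrt (k * r ^ 2 + 1) = S at *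
  generalize Real.arsinh (r * Real.sqrt k) = a at *
  have hqk : k = Real.sqrt k ^ 2 := (Real.sq_sqrt hk0.le).symm
  generalize Real.sqrt k = q at *
  subst hqk
  field_simp
  ring
end

section
/- Fix real constants a, b and define F(r) = 1 − a·r² − b·r⁴. Let r > 0 with F(r) > 0, let y be a real-valued function differentiable at r with y(r) > 0 and derivative y'(r). Then y'(r)·F(r) + (1/2)·y(r)·F'(r) + (r/2)·y(r)² = 0 (where F'(r) = −2ar − 4br³) holds if and only if the function s ↦ 1/(y(s)·√(F(s))) has derivative at r equal to r/(2·F(r)^{3/2}). -/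
/-- The Bernoulli-type TOV equation `y'F + ½yF' + (r/2)y² = 0` with
`F(r) = 1 − ar² − br⁴` holds iff `s ↦ 1/(y(s)√F(s))` has derivative
`r/(2F(r)^{3/2})` at `r`. -/
theorem stmt_11 (a b : ℝ) (r : ℝ) (hr : 0 < r)
    (hF : 0 < 1 - a * r ^ 2 - b * r ^ 4)
    (y : ℝ → ℝ) (hy : DifferentiableAt ℝ y r) (hypos : 0 < y r) :
    (deriv y r * (1 - a * r ^ 2 - b * r ^ 4)
        + 1 / 2 * y r * (-(2 * a * r) - 4 * b * r ^ 3)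
        + r / 2 * y r ^ 2 = 0)
      ↔ HasDerivAt
          (fun s : ℝ => 1 / (y s * Real.sqrt (1 - a * s ^ 2 - b * s ^ 4)))
          (r / (2 * (1 - a * r ^ 2 - b * r ^ 4) ^ ((3 : ℝ) / 2))) r := by
  have hFd : HasDerivAt (fun s : ℝ => 1 - a * s ^ 2 - b * s ^ 4)
      (-(2 * a * r) - 4 * b * r ^ 3) r := by
    have h1 := (((hasDerivAt_pow 2 r).const_mul a).const_sub 1).sub
      ((hasDerivAt_pow 4 r).const_mul b)
    refine h1.congr_deriv ?_
    push_cast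
    ring
  have hS := hFd.sqrt hF.ne'
  have hSpos := Real.sqrt_pos.mpr hF
  have hD := (hy.hasDerivAt.mul hS).inv (mul_pos hypos hSpos).ne'
  have hpow : (1 - a * r ^ 2 - b * r ^ 4) ^ ((3 : ℝ) / 2)
      = Real.sqrt (1 - a * r ^ 2 - b * r ^ 4) ^ 3 := by
    generalize 1 - a * r ^ 2 - b * r ^ 4 = G at hF ⊢
    rw [Real.sqrt_eq_rpow, ← Real.rpow_natCast, ← Real.rpow_mul hF.le]
    norm_num
  have hsq := Real.sq_sqrt hF.le
  have hD' : HasDerivAt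
      (fun s : ℝ => 1 / (y s * Real.sqrt (1 - a * s ^ 2 - b * s ^ 4)))
      (r / (2 * (1 - a * r ^ 2 - b * r ^ 4) ^ ((3 : ℝ) / 2))
        - (deriv y r * (1 - a * r ^ 2 - b * r ^ 4)
        + 1 / 2 * y r * (-(2 * a * r) - 4 * b * r ^ 3)
        + r / 2 * y r ^ 2) /
          (y r ^ 2 * Real.sqrt (1 - a * r ^ 2 - b * r ^ 4) ^ 3)) r := by
    have hfun : (fun s : ℝ => 1 / (y s * Real.sqrt (1 - a * s ^ 2 - b * s ^ 4)))
        = (y * fun s : ℝ => Real.sqrt (1 - a * s ^ 2 - b * s ^ 4))⁻¹ := by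
      funext s
      simp
    rw [hfun]
    refine hD.congr_deriv ?_
    rw [hpow]
    simp only [Pi.mul_apply]
    generalize -(2 * a * r) - 4 * b * r ^ 3 = F1 at *
    generalize Real.sqrt (1 - a * r ^ 2 - b * r ^ 4) = S at *
    rw [← hsq]
    have h1 := hSpos.ne'
    have h2 := hypos.ne'
    field_simp
    ring
  have hden : y r ^ 2 * Real.sqrt (1 - a * r ^ 2 - b * r ^ 4) ^ 3 ≠ 0 := by positivity
  constructor
  · intro h
    rw [h, zero_div, sub_zero] at hD'
    exact hD'
  · intro h
    have h3 := h.unique hD'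
    have h4 := sub_eq_self.mp h3.symm
    exact (div_eq_zero_iff.mp h4).resolve_right hden
end

section
/- Fix real constants a, b with a² + 4b ≠ 0, define F(r) = 1 − a·r² − b·r⁴, and fix μ > 0 and R > 0 with F(R) > 0. Let I ⊆ (0, ∞) be an interval containing R with F(r) > 0 for all r ∈ I, and let y : I → ℝ be differentiable with y(r) > 0 for all r ∈ I, y(R) = μ, and y'(r)·F(r) + (1/2)·y(r)·F'(r) + (r/2)·y(r)² = 0 on I. Then for all r ∈ I: 1/y(r) = (a + 2b·r²)/(2(a² + 4b)) + √(F(r)/F(R)) · ( 1/μ − (a + 2b·R²)/(2(a² + 4b)) ). -/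
/-- Explicit interior pressure profile of the uniform-density star: the
solution of the Bernoulli TOV equation with boundary value `y(R) = μ`. -/
theorem stmt_13 (a b : ℝ) (hab : a ^ 2 + 4 * b ≠ 0)
    (μ R : ℝ) (hμ : 0 < μ) (hR : 0 < R)
    (hFR : 0 < 1 - a * R ^ 2 - b * R ^ 4)
    (I : Set ℝ) (hIconn : I.OrdConnected) (hIpos : I ⊆ Set.Ioi 0) (hRI : R ∈ I)
    (hFI : ∀ r ∈ I, 0 < 1 - a * r ^ 2 - b * r ^ 4)
    (y : ℝ → ℝ) (hy : ∀ r ∈ I, DifferentiableAt ℝ y r)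
    (hypos : ∀ r ∈ I, 0 < y r) (hyR : y R = μ)
    (hode : ∀ r ∈ I,
      deriv y r * (1 - a * r ^ 2 - b * r ^ 4)
        + 1 / 2 * y r * (-(2 * a * r) - 4 * b * r ^ 3)
        + r / 2 * y r ^ 2 = 0) :
    ∀ r ∈ I,
      1 / y r = (a + 2 * b * r ^ 2) / (2 * (a ^ 2 + 4 * b))
        + Real.sqrt ((1 - a * r ^ 2 - b * r ^ 4) / (1 - a * R ^ 2 - b * R ^ 4))
          * (1 / μ - (a + 2 * b * R ^ 2) / (2 * (a ^ 2 + 4 * b))) := by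
  have hG : ∀ r ∈ I, HasDerivWithinAt
      (fun r => ((y r)⁻¹ - (a + 2 * b * r ^ 2) / (2 * (a ^ 2 + 4 * b)))
        / Real.sqrt (1 - a * r ^ 2 - b * r ^ 4)) 0 I r := by
    intro r hr
    have hF := hFI r hr
    have hyr := hypos r hr
    have hdF : HasDerivAt (fun r : ℝ => 1 - a * r ^ 2 - b * r ^ 4)
        (-(2 * a * r) - 4 * b * r ^ 3) r := by
      have h := (((hasDerivAt_pow 2 r).const_mul a).const_sub 1).sub
        ((hasDerivAt_pow 4 r).const_mul b)
      refine h.congr_deriv ?_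
      norm_num
      ring
    have hdp : HasDerivAt (fun r : ℝ => (a + 2 * b * r ^ 2) / (2 * (a ^ 2 + 4 * b)))
        (4 * b * r / (2 * (a ^ 2 + 4 * b))) r := by
      have h := (((hasDerivAt_pow 2 r).const_mul (2 * b)).const_add a).div_const
        (2 * (a ^ 2 + 4 * b))
      refine h.congr_deriv ?_
      norm_num
      ring
    have h := (((hy r hr).hasDerivAt.inv hyr.ne').sub hdp).div (hdF.sqrt hF.ne')
      (Real.sqrt_pos.2 hF).ne'
    refine (h.congr_deriv ?_).hasDerivWithinAt
    have hs := Real.sq_sqrt hF.le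
    have hs0 := Real.sqrt_pos.2 hF
    have hode' := hode r hr
    have hy' : deriv y r = -(1 / 2 * y r * (-(2 * a * r) - 4 * b * r ^ 3)
        + r / 2 * y r ^ 2) / (1 - a * r ^ 2 - b * r ^ 4) := by
      rw [eq_div_iff hF.ne']
      linarith
    simp only [Pi.sub_apply, Pi.inv_apply]
    rw [hy']
    generalize Real.sqrt (1 - a * r ^ 2 - b * r ^ 4) = s at *
    rw [← hs]
    rw [div_eq_zero_iff]
    left
    field_simp
    rw [hs]
    ring
  intro r hr
  have hc := hIconn.convex.norm_image_sub_le_of_norm_hasDerivWithin_le (C := 0)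
    hG (fun x _ => by simp) hRI hr
  rw [zero_mul, norm_le_zero_iff, sub_eq_zero] at hc
  have hs0 := Real.sqrt_pos.2 (hFI r hr)
  have hS0 := Real.sqrt_pos.2 hFR
  rw [Real.sqrt_div (hFI r hr).le]
  simp only [hyR] at hc
  rw [div_eq_iff hs0.ne'] at hc
  rw [one_div, one_div, sub_eq_iff_eq_add.1 hc]
  ring
end

section
/- Fix real constants μ, Λ, λ, set a = (μ + Λ)/3, b = λ/5, and F(r) = 1 − a·r² − b·r⁴. For every r > 0 with F(r) > 0, both functions b₁(r) = √(F(r)) and b₂(r) = (μ + Λ)/6 + (λ/5)·r² are twice differentiable at r and satisfy the linear second-order equation F(r)·w''(r) − (1/r + (λ/5)·r³)·w'(r) + (4λ/5)·r²·w(r) = 0; consequently so does every linear combination c₁·b₁ + c₂·b₂. -/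
/-- Assemble the second-order data of a function from explicit derivatives. -/
theorem ode_aux (f d : ℝ → ℝ) (e r P Q R : ℝ)
    (h1 : ∀ᶠ s in nhds r, HasDerivAt f (d s) s) (h2 : HasDerivAt d e r)
    (h : P * e - Q * d r + R * f r = 0) :
    DifferentiableAt ℝ f r ∧ DifferentiableAt ℝ (deriv f) r ∧
      P * deriv (deriv f) r - Q * deriv f r + R * f r = 0 := by
  have he : deriv f =ᶠ[nhds r] d := h1.mono fun s hs => hs.deriv
  have h2' : HasDerivAt (deriv f) e r := h2.congr_of_eventuallyEq he
  refine ⟨h1.self_of_nhds.differentiableAt, h2'.differentiableAt, ?_⟩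
  rw [h2'.deriv, h1.self_of_nhds.deriv, h]

/-- `√F(r)` and `(μ+Λ)/6 + (λ/5)r²` both solve the linear second-order
equation `F w'' − (1/r + (λ/5)r³) w' + (4λ/5) r² w = 0`, and hence so does
every linear combination of them. -/
theorem stmt_14 (μ Λ lam : ℝ) (r : ℝ) (hr : 0 < r)
    (hF : 0 < 1 - (μ + Λ) / 3 * r ^ 2 - lam / 5 * r ^ 4) :
    (let b₁ : ℝ → ℝ := fun s =>
        Real.sqrt (1 - (μ + Λ) / 3 * s ^ 2 - lam / 5 * s ^ 4)
     let b₂ : ℝ → ℝ := fun s => (μ + Λ) / 6 + lam / 5 * s ^ 2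
     (DifferentiableAt ℝ b₁ r ∧ DifferentiableAt ℝ (deriv b₁) r ∧
       (1 - (μ + Λ) / 3 * r ^ 2 - lam / 5 * r ^ 4) * deriv (deriv b₁) r
         - (1 / r + lam / 5 * r ^ 3) * deriv b₁ r
         + 4 * lam / 5 * r ^ 2 * b₁ r = 0) ∧
     (DifferentiableAt ℝ b₂ r ∧ DifferentiableAt ℝ (deriv b₂) r ∧
       (1 - (μ + Λ) / 3 * r ^ 2 - lam / 5 * r ^ 4) * deriv (deriv b₂) r
         - (1 / r + lam / 5 * r ^ 3) * deriv b₂ r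
         + 4 * lam / 5 * r ^ 2 * b₂ r = 0) ∧
     ∀ c₁ c₂ : ℝ,
       DifferentiableAt ℝ (fun s => c₁ * b₁ s + c₂ * b₂ s) r ∧
       DifferentiableAt ℝ (deriv (fun s => c₁ * b₁ s + c₂ * b₂ s)) r ∧
       (1 - (μ + Λ) / 3 * r ^ 2 - lam / 5 * r ^ 4)
           * deriv (deriv (fun s => c₁ * b₁ s + c₂ * b₂ s)) r
         - (1 / r + lam / 5 * r ^ 3)
           * deriv (fun s => c₁ * b₁ s + c₂ * b₂ s) r
         + 4 * lam / 5 * r ^ 2 * (c₁ * b₁ r + c₂ * b₂ r) = 0) := by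
  intro b₁ b₂
  set a := (μ + Λ) / 3 with ha
  set b := lam / 5 with hb
  have hlam : 4 * lam / 5 = 4 * b := by rw [hb]; ring
  have hFd : ∀ s : ℝ, HasDerivAt (fun s : ℝ => 1 - a * s ^ 2 - b * s ^ 4)
      (-2 * a * s - 4 * b * s ^ 3) s := by
    intro s
    have := (((hasDerivAt_const s (1 : ℝ)).sub ((hasDerivAt_pow 2 s).const_mul a)).sub
      ((hasDerivAt_pow 4 s).const_mul b))
    refine this.congr_deriv ?_
    norm_num
    ring
  have hev : ∀ᶠ s in nhds r, 0 < 1 - a * s ^ 2 - b * s ^ 4 :=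
    (hFd r).continuousAt.eventually (lt_mem_nhds hF)
  have h1 : ∀ s : ℝ, 0 < 1 - a * s ^ 2 - b * s ^ 4 →
      HasDerivAt b₁ ((-2 * a * s - 4 * b * s ^ 3) / (2 * b₁ s)) s :=
    fun s hs => (hFd s).sqrt hs.ne'
  have hpos : 0 < b₁ r := Real.sqrt_pos.2 hF
  have hsq : b₁ r ^ 2 = 1 - a * r ^ 2 - b * r ^ 4 := Real.sq_sqrt hF.le
  have hn : HasDerivAt (fun s : ℝ => -2 * a * s - 4 * b * s ^ 3)
      (-2 * a - 12 * b * r ^ 2) r := by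
    have := ((hasDerivAt_id r).const_mul (-2 * a)).sub ((hasDerivAt_pow 3 r).const_mul (4 * b))
    refine this.congr_deriv ?_
    norm_num
    ring
  have h1' := hn.div ((h1 r hF).const_mul 2) (by positivity)
  have h2 : ∀ s : ℝ, HasDerivAt b₂ (2 * b * s) s := by
    intro s
    have := ((hasDerivAt_pow 2 s).const_mul b).const_add ((μ + Λ) / 6)
    refine this.congr_deriv ?_
    norm_num
    ring
  have h2' : HasDerivAt (fun s : ℝ => 2 * b * s) (2 * b) r := by
    simpa using (hasDerivAt_id r).const_mul (2 * b)
  have hb2 : b₂ r = a / 2 + b * r ^ 2 := by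
    simp only [b₂, ha]; ring
  have hev1 := hev.mono h1
  rw [hlam]
  have E1 : (1 - a * r ^ 2 - b * r ^ 4) * (((-2 * a - 12 * b * r ^ 2) * (2 * b₁ r)
      - (-2 * a * r - 4 * b * r ^ 3) *
        (2 * ((-2 * a * r - 4 * b * r ^ 3) / (2 * b₁ r)))) / (2 * b₁ r) ^ 2)
      - (1 / r + b * r ^ 3) * ((-2 * a * r - 4 * b * r ^ 3) / (2 * b₁ r))
      + 4 * b * r ^ 2 * b₁ r = 0 := by
    rw [← hsq]
    generalize b₁ r = y at *
    field_simp
    have : y ^ 2 - (1 - a * r ^ 2 - b * r ^ 4) = 0 := by linarith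
    ring_nf
    ring_nf at this
    linear_combination (-4 * a - 8 * b * r ^ 2) * this
  have E2 : (1 - a * r ^ 2 - b * r ^ 4) * (2 * b) - (1 / r + b * r ^ 3) * (2 * b * r)
      + 4 * b * r ^ 2 * b₂ r = 0 := by
    rw [hb2]; field_simp; ring
  refine ⟨ode_aux _ _ _ _ _ _ _ hev1 h1' E1,
    ode_aux _ _ _ _ _ _ _ (Filter.Eventually.of_forall h2) h2' E2, fun c₁ c₂ => ?_⟩
  refine ode_aux (fun s => c₁ * b₁ s + c₂ * b₂ s) _ _ _ _ _ _
    (hev1.mono fun s hs => (hs.const_mul c₁).add ((h2 s).const_mul c₂))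
    ((h1'.const_mul c₁).add (h2'.const_mul c₂)) ?_
  linear_combination c₁ * E1 + c₂ * E2
end

section
/- Fix real constants μ, Λ, λ with ((μ+Λ)/6)² + λ/5 ≠ 0, set a = (μ + Λ)/3, b = λ/5, F(r) = 1 − a·r² − b·r⁴, fix R > 0 with F(R) > 0 and set γ = √(F(R)). Define c = (μ/4)·((μ+Λ)/6 + (λ/5)·R²)/(((μ+Λ)/6)² + λ/5) and B(r) = √(F(r))·(1 − c) + (μ/4)·((μ+Λ)/6 + (λ/5)·r²)/(((μ+Λ)/6)² + λ/5)·γ. Then for every r > 0 with F(r) > 0, B is differentiable at r and satisfies F(r)·B'(r) + 2·( ((μ+Λ)/6)·r + (λ/5)·r³ )·B(r) = (r/2)·γ·μ. -/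
/-- The explicit interior metric function `b₋(r)` of the uniform star
satisfies the first-order equation
`F b' + 2(((μ+Λ)/6)r + (λ/5)r³) b = (r/2)γμ`. -/
theorem stmt_15 (μ Λ lam : ℝ) (hne : ((μ + Λ) / 6) ^ 2 + lam / 5 ≠ 0)
    (R : ℝ) (hR : 0 < R)
    (hFR : 0 < 1 - (μ + Λ) / 3 * R ^ 2 - lam / 5 * R ^ 4)
    (γ c : ℝ) (B : ℝ → ℝ)
    (hγ : γ = Real.sqrt (1 - (μ + Λ) / 3 * R ^ 2 - lam / 5 * R ^ 4))
    (hc : c = μ / 4 * ((μ + Λ) / 6 + lam / 5 * R ^ 2)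
        / (((μ + Λ) / 6) ^ 2 + lam / 5))
    (hB : B = fun s : ℝ =>
      Real.sqrt (1 - (μ + Λ) / 3 * s ^ 2 - lam / 5 * s ^ 4) * (1 - c)
        + μ / 4 * ((μ + Λ) / 6 + lam / 5 * s ^ 2)
            / (((μ + Λ) / 6) ^ 2 + lam / 5) * γ) :
    ∀ r : ℝ, 0 < r → 0 < 1 - (μ + Λ) / 3 * r ^ 2 - lam / 5 * r ^ 4 →
      DifferentiableAt ℝ B r ∧
      (1 - (μ + Λ) / 3 * r ^ 2 - lam / 5 * r ^ 4) * deriv B r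
        + 2 * ((μ + Λ) / 6 * r + lam / 5 * r ^ 3) * B r
        = r / 2 * γ * μ := by
  intro r _ hF
  set D : ℝ := ((μ + Λ) / 6) ^ 2 + lam / 5 with hD
  have hFd : HasDerivAt (fun s : ℝ => 1 - (μ + Λ) / 3 * s ^ 2 - lam / 5 * s ^ 4)
      (-(4 * ((μ + Λ) / 6 * r + lam / 5 * r ^ 3))) r := by
    have h2 := (hasDerivAt_pow 2 r).const_mul ((μ + Λ) / 3)
    have h4 := (hasDerivAt_pow 4 r).const_mul (lam / 5)
    refine ((h2.const_sub 1).sub h4).congr_deriv ?_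
    norm_num
    ring
  have hP : HasDerivAt (fun s : ℝ => μ / 4 * ((μ + Λ) / 6 + lam / 5 * s ^ 2) / D * γ)
      (μ / 4 * (lam / 5 * (2 * r)) / D * γ) r := by
    have h2 := (hasDerivAt_pow 2 r).const_mul (lam / 5)
    refine ((((h2.const_add ((μ + Λ) / 6)).const_mul (μ / 4)).div_const D).mul_const γ).congr_deriv ?_
    norm_num
  have hBd := ((hFd.sqrt hF.ne').mul_const (1 - c)).add hP
  have hBd' : HasDerivAt B (-(4 * ((μ + Λ) / 6 * r + lam / 5 * r ^ 3)) /
      (2 * Real.sqrt (1 - (μ + Λ) / 3 * r ^ 2 - lam / 5 * r ^ 4)) * (1 - c) +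
      μ / 4 * (lam / 5 * (2 * r)) / D * γ) r := by
    rw [hB]
    exact hBd
  refine ⟨hBd'.differentiableAt, ?_⟩
  rw [hBd'.deriv, hB]
  have hs := Real.sq_sqrt hF.le
  have hpos := Real.sqrt_pos.mpr hF
  beta_reduce
  set S := Real.sqrt (1 - (μ + Λ) / 3 * r ^ 2 - lam / 5 * r ^ 4) with hS
  have h1 : (1 - (μ + Λ) / 3 * r ^ 2 - lam / 5 * r ^ 4) *
      (-(4 * ((μ + Λ) / 6 * r + lam / 5 * r ^ 3)) / (2 * S)) =
      -(2 * ((μ + Λ) / 6 * r + lam / 5 * r ^ 3)) * S := by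
    rw [← hs]
    field_simp
    ring
  have h2 : (1 - (μ + Λ) / 3 * r ^ 2 - lam / 5 * r ^ 4) *
      (μ / 4 * (lam / 5 * (2 * r)) / D * γ) + 2 * ((μ + Λ) / 6 * r + lam / 5 * r ^ 3) *
      (μ / 4 * ((μ + Λ) / 6 + lam / 5 * r ^ 2) / D * γ) = r / 2 * γ * μ := by
    have h3 : D * D⁻¹ = 1 := mul_inv_cancel₀ hne
    rw [div_eq_mul_inv _ D, div_eq_mul_inv _ D]
    have h4 : r / 2 * γ * μ = r / 2 * γ * μ * (D * D⁻¹) := by rw [h3, mul_one]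
    rw [h4]
    generalize D⁻¹ = E
    rw [hD]
    ring
  linear_combination (1 - c) * h1 + h2
end

section
/- For every real X with 4/5 ≤ X < 4/3, setting Y = X²·(8/9 − X)/(4/3 − X)², one has 1 − X − Y ≥ 0 and 0 = −1/6 + (4/3)·Y/X² − Y/X + (1/2)·√(1 − X − Y). -/
/-- On the physical branch `4/5 ≤ X < 4/3`, with
`Y = X²(8/9 − X)/(4/3 − X)²`, the central-pressure divergence condition
`0 = −1/6 + (4/3)Y/X² − Y/X + ½√(1 − X − Y)` is satisfied. -/
theorem stmt_17 (X : ℝ) (h1 : 4 / 5 ≤ X) (h2 : X < 4 / 3) :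
    1 - X - X ^ 2 * (8 / 9 - X) / (4 / 3 - X) ^ 2 ≥ 0 ∧
    0 = -(1 / 6)
      + 4 / 3 * (X ^ 2 * (8 / 9 - X) / (4 / 3 - X) ^ 2) / X ^ 2
      - X ^ 2 * (8 / 9 - X) / (4 / 3 - X) ^ 2 / X
      + 1 / 2 * Real.sqrt (1 - X - X ^ 2 * (8 / 9 - X) / (4 / 3 - X) ^ 2) := by
  have hd : 0 < 4 / 3 - X := by linarith
  have hX : X ≠ 0 := by
    intro h
    rw [h] at h1
    norm_num at h1
  have hd' : 4 / 3 - X ≠ 0 := hd.ne'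
  have key : 1 - X - X ^ 2 * (8 / 9 - X) / (4 / 3 - X) ^ 2
      = ((5 * X - 4) / (3 * (4 / 3 - X))) ^ 2 := by
    generalize hD : 4 / 3 - X = D at *
    obtain rfl : X = 4 / 3 - D := by linarith
    field_simp
    ring
  have hn : 0 ≤ (5 * X - 4) / (3 * (4 / 3 - X)) :=
    div_nonneg (by linarith) (by linarith)
  refine ⟨by rw [key]; exact sq_nonneg _, ?_⟩
  rw [key, Real.sqrt_sq hn]
  have e1 : 4 / 3 * (X ^ 2 * (8 / 9 - X) / (4 / 3 - X) ^ 2) / X ^ 2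
      = 4 / 3 * (8 / 9 - X) / (4 / 3 - X) ^ 2 := by
    generalize 4 / 3 - X = D at *
    field_simp
  have e2 : X ^ 2 * (8 / 9 - X) / (4 / 3 - X) ^ 2 / X
      = X * (8 / 9 - X) / (4 / 3 - X) ^ 2 := by
    generalize 4 / 3 - X = D at *
    field_simp
  rw [e1, e2]
  clear e1 e2 key hn
  generalize hD : 4 / 3 - X = D at *
  obtain rfl : X = 4 / 3 - D := by linarith
  field_simp
  ring
end
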